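/- arXiv:1705.07863 — 5 statements merged into one kernel-verified Lean document; each statement's English description precedes it below -/
import Mathlib

section
/- For every h > 0 and every p ≥ 0, (h²·p − g(h)²)/(2·(σ² + g(h)²)) ≤ (p − P_WF(h))/(2λ). (This is the per-block bound used to replace the mean of the information density by the water-filling expression in the converse proof.) -/
/-- For every `h > 0` and `p ≥ 0`,
`(h² p − g(h)²) / (2 (σ² + g(h)²)) ≤ (p − P_WF(h)) / (2 λ)`, where
`P_WF(h) = max (λ - σ²/h²) 0` and `g(h)² = h² P_WF(h)`. -/
theorem per_block_mean_bound (σ lam : ℝ) (hσ : 0 < σ) (hlam : 0 < lam)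
    (h p : ℝ) (hh : 0 < h) (hp : 0 ≤ p) :
    (h ^ 2 * p - h ^ 2 * max (lam - σ ^ 2 / h ^ 2) 0)
        / (2 * (σ ^ 2 + h ^ 2 * max (lam - σ ^ 2 / h ^ 2) 0))
      ≤ (p - max (lam - σ ^ 2 / h ^ 2) 0) / (2 * lam) := by
  have hh2 : 0 < h ^ 2 := by positivity
  rcases le_total (lam - σ ^ 2 / h ^ 2) 0 with hle | hge
  · rw [max_eq_right hle]
    have hlow : lam * h ^ 2 ≤ σ ^ 2 := (le_div_iff₀ hh2).mp (by linarith)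
    simp only [mul_zero, sub_zero, add_zero]
    rw [div_le_div_iff₀ (by positivity) (by positivity)]
    nlinarith [mul_le_mul_of_nonneg_left hlow hp]
  · rw [max_eq_left hge]
    have hden : σ ^ 2 + h ^ 2 * (lam - σ ^ 2 / h ^ 2) = h ^ 2 * lam := by
      field_simp
      ring
    rw [hden, ← mul_sub, mul_left_comm, mul_div_mul_left _ _ hh2.ne']
end

section
/- Let the fading take finitely many values η_1, …, η_m > 0 with probabilities q_1, …, q_m > 0 summing to 1, and let P̄ = Σ_i q_i·P_WF(η_i) be the average water-filling power. Then the average dispersion satisfies Σ_i q_i·V(η_i²·P_WF(η_i)) ≥ P̄²/(2λ²). -/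
/-- At the water-filling power `P` for fading value `h`, the function `L` takes the value `P / lam`. -/
lemma snr_ratio_waterFilling {σ lam h : ℝ} (hh : 0 < h) :
    h ^ 2 * max (lam - σ ^ 2 / h ^ 2) 0 / (σ ^ 2 + h ^ 2 * max (lam - σ ^ 2 / h ^ 2) 0) =
      max (lam - σ ^ 2 / h ^ 2) 0 / lam := by
  rcases le_total (lam - σ ^ 2 / h ^ 2) 0 with hle | hle
  · simp [max_eq_right hle]
  · have hden : σ ^ 2 + h ^ 2 * (lam - σ ^ 2 / h ^ 2) = h ^ 2 * lam := by
      field_simp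
      ring
    rw [max_eq_left hle, hden, mul_div_mul_left _ _ (by positivity)]

/-- Let the fading take finitely many values `η i > 0` with probabilities `q i > 0`
summing to `1`, and let `P̄ = ∑ i, q i * P_WF (η i)` be the average water-filling
power, where `P_WF(h) = max (λ - σ²/h²) 0`.  Then the average dispersion satisfies
`∑ i, q i * V (η i ^ 2 * P_WF (η i)) ≥ P̄² / (2 λ²)`, where
`V(x) = (1/2) (1 - (1 - L x)²)` and `L x = x / (σ² + x)`. -/
theorem average_dispersion_lower_bound (σ lam : ℝ) (hσ : 0 < σ) (hlam : 0 < lam)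
    {m : ℕ} (η q : Fin m → ℝ) (hη : ∀ i, 0 < η i) (hq : ∀ i, 0 < q i)
    (hqsum : ∑ i, q i = 1)
    (Pbar : ℝ) (hPbar : Pbar = ∑ i, q i * max (lam - σ ^ 2 / (η i) ^ 2) 0) :
    Pbar ^ 2 / (2 * lam ^ 2) ≤
      ∑ i, q i * ((1 : ℝ) / 2 *
        (1 - (1 - (η i) ^ 2 * max (lam - σ ^ 2 / (η i) ^ 2) 0
          / (σ ^ 2 + (η i) ^ 2 * max (lam - σ ^ 2 / (η i) ^ 2) 0)) ^ 2)) := by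
  subst hPbar
  have hterm (i : Fin m) :
      q i * (max (lam - σ ^ 2 / (η i) ^ 2) 0) ^ 2 / (2 * lam ^ 2) ≤
        q i * ((1 : ℝ) / 2 * (1 - (1 - (η i) ^ 2 * max (lam - σ ^ 2 / (η i) ^ 2) 0
          / (σ ^ 2 + (η i) ^ 2 * max (lam - σ ^ 2 / (η i) ^ 2) 0)) ^ 2)) := by
    have hle : max (lam - σ ^ 2 / (η i) ^ 2) 0 ≤ lam :=
      max_le (sub_le_self _ (by positivity)) hlam.le
    have hnonneg : 0 ≤ max (lam - σ ^ 2 / (η i) ^ 2) 0 := le_max_right _ _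
    rw [snr_ratio_waterFilling (hη i), mul_div_assoc]
    generalize max (lam - σ ^ 2 / (η i) ^ 2) 0 = P at hle hnonneg ⊢
    have hL0 : 0 ≤ P / lam := div_nonneg hnonneg hlam.le
    have hL1 : P / lam ≤ 1 := (div_le_one hlam).mpr hle
    have hsq : P ^ 2 / (2 * lam ^ 2) = (P / lam) ^ 2 / 2 := by
      field_simp
    rw [hsq]
    exact mul_le_mul_of_nonneg_left (by nlinarith [mul_nonneg hL0 (sub_nonneg.mpr hL1)]) (hq i).le
  calc
    _ ≤ (∑ i, q i * (max (lam - σ ^ 2 / (η i) ^ 2) 0) ^ 2) / (2 * lam ^ 2) := by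
      gcongr
      exact Real.pow_arith_mean_le_arith_mean_pow _ _ _ (fun i _ => (hq i).le) hqsum
        (fun i _ => le_max_right _ _) 2
    _ ≤ _ := by
      rw [Finset.sum_div]
      exact Finset.sum_le_sum fun i _ => hterm i
end

section
/- There exist constants K₀, K₁, K₂, K₃ > 0, depending only on σ and λ, such that for every h > 0 and every p ≥ 0, with g² = h²·P_WF(h) and W(z) = (2·h·σ²·√p·z − g²·(z² − 1))/(2·σ²·(σ² + g²)), the third absolute moment under the standard Gaussian measure γ on ℝ satisfies ∫ |W(z)|³ dγ(z) ≤ K₃·p³ + K₂·p² + K₁·p + K₀. -/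
open MeasureTheory ProbabilityTheory in
lemma integrable_sq_add_one_cube_gaussianReal :
    Integrable (fun z : ℝ ↦ (z ^ 2 + 1) ^ 3) (gaussianReal 0 1) := by
  have hpow (n : ℕ) : Integrable (fun z : ℝ ↦ z ^ n) (gaussianReal 0 1) :=
    integrable_pow_of_mem_interior_integrableExpSet (X := id) (by simp) n
  have h := (((hpow 6).add ((hpow 4).const_mul 3)).add ((hpow 2).const_mul 3)).add
    (integrable_const (1 : ℝ))
  refine h.congr (.of_forall fun z ↦ ?_)
  simp only [Pi.add_apply]
  ring

/-- If `D` dominates `σ²`, `λ h²` and `G`, the quadratic form in `z` is dominated by a multiple of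
`z² + 1` that is affine in `p`. -/
lemma abs_quadratic_div_le {σ lam h p G D : ℝ} (hσ : 0 < σ) (hlam : 0 < lam) (hp : 0 ≤ p)
    (hG : 0 ≤ G) (hGD : G ≤ D) (hσD : σ ^ 2 ≤ D) (hhD : lam * h ^ 2 ≤ D) (z : ℝ) :
    |(2 * h * σ ^ 2 * Real.sqrt p * z - G * (z ^ 2 - 1)) / (2 * σ ^ 2 * D)| ≤
      (1 / (2 * lam * σ ^ 2) * p + (1 / 2 + 1 / (2 * σ ^ 2))) * (z ^ 2 + 1) := by
  have hσ2 : 0 < σ ^ 2 := by positivity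
  have hD : 0 < D := hσ2.trans_le hσD
  set a := h * Real.sqrt p / D with ha
  set b := G / (2 * σ ^ 2 * D) with hb
  have hW : (2 * h * σ ^ 2 * Real.sqrt p * z - G * (z ^ 2 - 1)) / (2 * σ ^ 2 * D) =
      a * z - b * (z ^ 2 - 1) := by
    rw [ha, hb]
    field_simp
  have ha2 : a ^ 2 ≤ p / (lam * σ ^ 2) := by
    rw [ha, div_pow, mul_pow, Real.sq_sqrt hp, div_le_div_iff₀ (by positivity) (by positivity)]
    have : lam * h ^ 2 * σ ^ 2 ≤ D * D := by gcongr
    nlinarith [mul_le_mul_of_nonneg_left this hp]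
  have hb0 : 0 ≤ b := by positivity
  have hb1 : b ≤ 1 / (2 * σ ^ 2) := by
    rw [hb, div_le_div_iff₀ (by positivity) (by positivity)]
    nlinarith [mul_le_mul_of_nonneg_left hGD hσ2.le]
  have haz : |a * z| ≤ (a ^ 2 + z ^ 2) / 2 := by
    rw [abs_le]
    constructor <;> nlinarith [sq_nonneg (a + z), sq_nonneg (a - z)]
  have hbz : |b * (z ^ 2 - 1)| ≤ 1 / (2 * σ ^ 2) * (z ^ 2 + 1) := by
    rw [abs_mul, abs_of_nonneg hb0]
    have : |z ^ 2 - 1| ≤ z ^ 2 + 1 := by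
      rw [abs_le]
      constructor <;> nlinarith [sq_nonneg z]
    gcongr
  have hc : 1 / (2 * lam * σ ^ 2) * p = p / (lam * σ ^ 2) / 2 := by field_simp
  have hcz : 0 ≤ p / (lam * σ ^ 2) * z ^ 2 := by positivity
  rw [hW, hc]
  have := abs_sub (a * z) (b * (z ^ 2 - 1))
  nlinarith


open MeasureTheory ProbabilityTheory in
/-- There exist constants `K₀, K₁, K₂, K₃ > 0`, depending only on `σ` and `λ`,
such that for every `h > 0` and `p ≥ 0`, with `g² = h² P_WF(h)` (where
`P_WF(h) = max (λ - σ²/h²) 0`) and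
`W z = (2 h σ² √p z − g² (z² − 1)) / (2 σ² (σ² + g²))`, the third absolute moment
of `W` under the standard Gaussian measure satisfies
`∫ |W z|³ dγ(z) ≤ K₃ p³ + K₂ p² + K₁ p + K₀`. -/
theorem third_moment_poly_bound (σ lam : ℝ) (hσ : 0 < σ) (hlam : 0 < lam) :
    ∃ K₀ K₁ K₂ K₃ : ℝ, 0 < K₀ ∧ 0 < K₁ ∧ 0 < K₂ ∧ 0 < K₃ ∧
      ∀ h p : ℝ, 0 < h → 0 ≤ p →
        (∫ z, |(2 * h * σ ^ 2 * Real.sqrt p * z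
              - (h ^ 2 * max (lam - σ ^ 2 / h ^ 2) 0) * (z ^ 2 - 1))
            / (2 * σ ^ 2 * (σ ^ 2 + h ^ 2 * max (lam - σ ^ 2 / h ^ 2) 0))| ^ 3
          ∂(gaussianReal 0 1))
        ≤ K₃ * p ^ 3 + K₂ * p ^ 2 + K₁ * p + K₀ := by
  set M := ∫ z : ℝ, (z ^ 2 + 1) ^ 3 ∂(gaussianReal 0 1)
  have hM : 0 ≤ M := integral_nonneg fun z ↦ by positivity
  set c := 1 / (2 * lam * σ ^ 2)
  set d := 1 / 2 + 1 / (2 * σ ^ 2)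
  have hc0 : 0 < c := by positivity
  have hd0 : 0 < d := by positivity
  refine ⟨d ^ 3 * (M + 1), 3 * c * d ^ 2 * (M + 1), 3 * c ^ 2 * d * (M + 1), c ^ 3 * (M + 1),
    by positivity, by positivity, by positivity, by positivity, fun h p hh hp ↦ ?_⟩
  set G := h ^ 2 * max (lam - σ ^ 2 / h ^ 2) 0 with hGdef
  have hG : 0 ≤ G := by positivity
  have hhG : lam * h ^ 2 ≤ σ ^ 2 + G := by
    have h1 : h ^ 2 * (lam - σ ^ 2 / h ^ 2) ≤ G := by
      rw [hGdef]
      gcongr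
      exact le_max_left _ _
    have h2 : h ^ 2 * (lam - σ ^ 2 / h ^ 2) = lam * h ^ 2 - σ ^ 2 := by field_simp
    linarith
  calc _ ≤ ∫ z : ℝ, (c * p + d) ^ 3 * (z ^ 2 + 1) ^ 3 ∂(gaussianReal 0 1) := by
        refine integral_mono_of_nonneg (.of_forall fun z ↦ by positivity)
          (integrable_sq_add_one_cube_gaussianReal.const_mul _) (.of_forall fun z ↦ ?_)
        simp only [← mul_pow]
        exact pow_le_pow_left₀ (abs_nonneg _) (abs_quadratic_div_le hσ hlam hp hG
          (by nlinarith) (by linarith) hhG z) 3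
    _ = (c * p + d) ^ 3 * M := integral_const_mul _ _
    _ ≤ (c * p + d) ^ 3 * (M + 1) := by
        gcongr
        linarith
    _ = _ := by ring
end

section
/- Fix a finite set {η_1, …, η_m}, probabilities q_1, …, q_m > 0 summing to 1, and P̄ > 0. Then there exists a constant C > 0, depending only on (q_i) and P̄ (not on B), such that for every positive integer B and every function P : {η_1, …, η_m}^B → [0, ∞)^m satisfying Σ_{i=1}^m t_i(h)·P_i(h) = P̄ for every h ∈ {η_1, …, η_m}^B (where t_i(h) = (1/B)·#{b : h_b = η_i}), one has E[ Σ_{i=1}^m t_i(H)·P_i(H)³ ] ≤ C, the expectation being over H = (H_1, …, H_B) i.i.d. with P(H_1 = η_i) = q_i. -/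
/-- The expectation of `f` under the binomial law with `n` trials and success probability `p`,
computed by conditioning on one trial at a time. -/
noncomputable def binomialMean (p : ℝ) : ℕ → (ℕ → ℝ) → ℝ
  | 0, f => f 0
  | n + 1, f => p * binomialMean p n (fun k => f (k + 1)) + (1 - p) * binomialMean p n f

theorem binomialMean_add (p : ℝ) (n : ℕ) (f g : ℕ → ℝ) :
    binomialMean p n (fun k => f k + g k) = binomialMean p n f + binomialMean p n g := by
  induction n generalizing f g with
  | zero => rfl
  | succ n ih => simp only [binomialMean, ih]; ring

theorem binomialMean_const (p : ℝ) (n : ℕ) (c : ℝ) : binomialMean p n (fun _ => c) = c := by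
  induction n with
  | zero => rfl
  | succ n ih => simp only [binomialMean, ih]; ring

theorem binomialMean_mono {p : ℝ} (hp₀ : 0 ≤ p) (hp₁ : p ≤ 1) (n : ℕ) {f g : ℕ → ℝ}
    (hfg : ∀ k, f k ≤ g k) : binomialMean p n f ≤ binomialMean p n g := by
  induction n generalizing f g with
  | zero => exact hfg 0
  | succ n ih =>
    exact add_le_add (mul_le_mul_of_nonneg_left (ih fun k => hfg (k + 1)) hp₀)
      (mul_le_mul_of_nonneg_left (ih hfg) (sub_nonneg.2 hp₁))

/-- The size-biasing identity for the binomial law. -/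
theorem binomialMean_succ_mul (p : ℝ) (n : ℕ) (f : ℕ → ℝ) :
    binomialMean p (n + 1) (fun k => k * f k) =
      (n + 1) * p * binomialMean p n (fun k => f (k + 1)) := by
  induction n generalizing f with
  | zero => simp [binomialMean]
  | succ n ih =>
    have hsplit : (fun k : ℕ => ((k + 1 : ℕ) : ℝ) * f (k + 1)) =
        fun k : ℕ => k * f (k + 1) + f (k + 1) := by
      funext k
      push_cast
      ring
    rw [binomialMean, hsplit, binomialMean_add, ih fun k => f (k + 1), ih f]
    simp only [binomialMean]
    push_cast
    ring

theorem binomialMean_inv_succ_le {p : ℝ} (hp₀ : 0 ≤ p) (hp₁ : p ≤ 1) (n : ℕ) :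
    (n + 1) * p * binomialMean p n (fun k => 1 / ((k : ℝ) + 1)) ≤ 1 := by
  have h := binomialMean_succ_mul p n fun k => 1 / (k : ℝ)
  push_cast at h
  rw [← h]
  refine (binomialMean_mono hp₀ hp₁ _ fun k => ?_).trans_eq (binomialMean_const p (n + 1) 1)
  rw [mul_one_div]
  exact div_self_le_one _

theorem binomialMean_inv_succ_mul_succ_le {p : ℝ} (hp₀ : 0 ≤ p) (hp₁ : p ≤ 1) (n : ℕ) :
    (n + 1) * (n + 2) * p ^ 2 *
      binomialMean p n (fun k => 1 / (((k : ℝ) + 1) * (k + 2))) ≤ 1 := by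
  have h := binomialMean_succ_mul p n fun k => 1 / ((k : ℝ) * (k + 1))
  have hle : binomialMean p (n + 1) (fun k => (k : ℝ) * (1 / ((k : ℝ) * (k + 1)))) ≤
      binomialMean p (n + 1) (fun k => 1 / ((k : ℝ) + 1)) := by
    refine binomialMean_mono hp₀ hp₁ _ fun k => ?_
    rcases k with _ | k
    · simp
    · apply le_of_eq
      push_cast
      field_simp
  have hshift : (fun k : ℕ => 1 / (((k + 1 : ℕ) : ℝ) * ((k + 1 : ℕ) + 1))) =
      fun k : ℕ => 1 / (((k : ℝ) + 1) * (k + 2)) := by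
    funext k
    push_cast
    ring
  rw [hshift] at h
  rw [h] at hle
  have h₁ := binomialMean_inv_succ_le hp₀ hp₁ (n + 1)
  push_cast at h₁
  have h₂ := mul_le_mul_of_nonneg_left hle (by positivity : (0 : ℝ) ≤ (n + 2) * p)
  linarith

/-- The number of coordinates equal to `i` in an i.i.d. sequence is binomially distributed. -/
theorem sum_prod_mul_card_filter_eq {ι : Type*} [Fintype ι] [DecidableEq ι] (q : ι → ℝ)
    (hq : ∑ i, q i = 1) (i : ι) (n : ℕ) (f : ℕ → ℝ) :
    ∑ h : Fin n → ι, (∏ b, q (h b)) * f (Finset.univ.filter fun b => h b = i).card =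
      binomialMean (q i) n f := by
  induction n generalizing f with
  | zero => simp [binomialMean]
  | succ n ih =>
    rw [← (Fin.consEquiv fun _ : Fin (n + 1) => ι).sum_comp, Fintype.sum_prod_type]
    simp only [Fin.consEquiv_apply, Fin.prod_univ_succ, Fin.cons_zero, Fin.cons_succ,
      Fin.card_filter_univ_succ, mul_assoc, ← Finset.mul_sum]
    rw [← Finset.add_sum_erase _ _ (Finset.mem_univ i), binomialMean]
    have hrest : ∑ j ∈ Finset.univ.erase i, q j = 1 - q i := by
      rw [← hq, ← Finset.add_sum_erase _ _ (Finset.mem_univ i)]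
      ring
    congr 1
    · simp only [if_true]
      rw [← ih]
    · rw [← hrest, Finset.sum_mul]
      refine Finset.sum_congr rfl fun j hj => ?_
      simp only [if_neg (Finset.ne_of_mem_erase hj)]
      rw [← ih]

theorem div_mul_pow_three_le {N B : ℕ} (hB : 0 < B) {x c : ℝ} (hx : 0 ≤ x) (hc : 0 ≤ c)
    (h : (N : ℝ) / B * x ≤ c) :
    (N : ℝ) / B * x ^ 3 ≤ 6 * c ^ 3 * B ^ 2 * (1 / (((N : ℝ) + 1) * (N + 2))) := by
  rcases Nat.eq_zero_or_pos N with rfl | hN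
  · simp only [Nat.cast_zero, zero_div, zero_mul]
    positivity
  have hN' : (1 : ℝ) ≤ N := by exact_mod_cast hN
  have hB' : (0 : ℝ) < B := by exact_mod_cast hB
  calc (N : ℝ) / B * x ^ 3 = ((N : ℝ) / B * x) ^ 3 * B ^ 2 * (1 / (N : ℝ) ^ 2) := by
        field_simp
    _ ≤ c ^ 3 * B ^ 2 * (6 * (1 / (((N : ℝ) + 1) * (N + 2)))) := by
        gcongr
        rw [mul_one_div, div_le_div_iff₀ (by positivity) (by positivity)]
        nlinarith
    _ = _ := by ring

/-- Fix a finite set of fading states indexed by `Fin m`, probabilities `q i > 0`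
summing to one, and a power budget `P̄ > 0`.  There is a constant `C > 0`,
independent of the number of blocks `B`, such that for every `B ≥ 1` and every
power allocation rule `P : (Fin m)^B → [0, ∞)^m` satisfying the empirical power
constraint `∑ i, t i h * P h i = P̄` for every fading realization `h` (where
`t i h = (1/B) #{b : h b = i}`), the expected empirical third moment of the
allocated power satisfies `E[∑ i, t i H * (P H i)³] ≤ C`, the expectation being
over `H` i.i.d. with law `q`. -/
theorem expected_third_moment_bound {m : ℕ} (hm : 0 < m)
    (q : Fin m → ℝ) (hq : ∀ i, 0 < q i) (hqsum : ∑ i, q i = 1)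
    (Pbar : ℝ) (hPbar : 0 < Pbar) :
    ∃ C : ℝ, 0 < C ∧
      ∀ (B : ℕ), 0 < B →
        ∀ P : (Fin B → Fin m) → Fin m → ℝ,
          (∀ h i, 0 ≤ P h i) →
          (∀ h : Fin B → Fin m,
            ∑ i, (((Finset.univ.filter fun b => h b = i).card : ℝ) / B) * P h i = Pbar) →
          ∑ h : Fin B → Fin m, (∏ b, q (h b)) *
              ∑ i, (((Finset.univ.filter fun b => h b = i).card : ℝ) / B) * (P h i) ^ 3
            ≤ C := by
  have hq₁ (i : Fin m) : q i ≤ 1 :=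
    hqsum ▸ Finset.single_le_sum (fun j _ => (hq j).le) (Finset.mem_univ i)
  have : Nonempty (Fin m) := ⟨⟨0, hm⟩⟩
  refine ⟨∑ i, 6 * Pbar ^ 3 / q i ^ 2,
    Finset.sum_pos (fun i _ => by have := hq i; positivity) Finset.univ_nonempty, ?_⟩
  intro B hB P hP hconstr
  calc _ ≤ ∑ h : Fin B → Fin m, (∏ b, q (h b)) * ∑ i, 6 * Pbar ^ 3 * B ^ 2 *
          (1 / ((((Finset.univ.filter fun b => h b = i).card : ℝ) + 1) *
            ((Finset.univ.filter fun b => h b = i).card + 2))) := by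
        refine Finset.sum_le_sum fun h _ => mul_le_mul_of_nonneg_left
          (Finset.sum_le_sum fun i _ => div_mul_pow_three_le hB (hP h i) hPbar.le ?_)
          (Finset.prod_nonneg fun b _ => (hq _).le)
        rw [← hconstr h]
        exact Finset.single_le_sum
          (f := fun i => ((Finset.univ.filter fun b => h b = i).card : ℝ) / B * P h i)
          (fun j _ => mul_nonneg (by positivity) (hP h j)) (Finset.mem_univ i)
    _ = ∑ i, 6 * Pbar ^ 3 * B ^ 2 *
          binomialMean (q i) B (fun k => 1 / (((k : ℝ) + 1) * (k + 2))) := by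
        simp only [Finset.mul_sum, ← sum_prod_mul_card_filter_eq q hqsum]
        rw [Finset.sum_comm]
        exact Finset.sum_congr rfl fun i _ => Finset.sum_congr rfl fun h _ => by ring
    _ ≤ _ := by
        refine Finset.sum_le_sum fun i _ => ?_
        have hqi := hq i
        have hmean : 0 ≤ binomialMean (q i) B (fun k => 1 / (((k : ℝ) + 1) * (k + 2))) := by
          rw [← binomialMean_const (q i) B 0]
          exact binomialMean_mono hqi.le (hq₁ i) B fun k => by positivity
        have hbound := binomialMean_inv_succ_mul_succ_le hqi.le (hq₁ i) B
        set M := binomialMean (q i) B (fun k => 1 / (((k : ℝ) + 1) * (k + 2)))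
        rw [le_div_iff₀ (by positivity)]
        have hle : (B : ℝ) ^ 2 * q i ^ 2 * M ≤ 1 := by
          refine le_trans ?_ hbound
          gcongr
          nlinarith [(Nat.cast_nonneg B : (0 : ℝ) ≤ B)]
        calc _ = 6 * Pbar ^ 3 * ((B : ℝ) ^ 2 * q i ^ 2 * M) := by ring
          _ ≤ 6 * Pbar ^ 3 := mul_le_of_le_one_right (by positivity) hle
end

section
/- Fix η_1, …, η_m > 0, probabilities q_1, …, q_m > 0 summing to 1, σ > 0, λ > 0 and P̄ > 0; set g_i² = η_i²·P_WF(η_i). Then there exists a constant C′ > 0, independent of B, such that for every positive integer B and every function P : {η_1, …, η_m}^B → [0, ∞)^m satisfying Σ_i t_i(h)·P_i(h) = P̄ for all h (with t_i(h) = (1/B)·#{b : h_b = η_i}), the Berry–Esseen ratio satisfies E[ τ(H)/ν(H)^{3/2} ] ≤ C′/√B, where for h ∈ {η_1, …, η_m}^B with h_b = η_{i(b)}: ν(h) = Σ_{b=1}^B (2σ²·h_b²·P_{i(b)}(h) + g_{i(b)}⁴)/(2·(σ² + g_{i(b)}²)²), τ(h) = Σ_{b=1}^B ∫ |W_b(z)|³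 dγ(z) with W_b(z) = (2·h_b·σ²·√(P_{i(b)}(h))·z − g_{i(b)}²·(z² − 1))/(2·σ²·(σ² + g_{i(b)}²)), γ the standard Gaussian measure on ℝ, and the outer expectation is over H = (H_1, …, H_B) i.i.d. with P(H_1 = η_i) = q_i. -/
open MeasureTheory ProbabilityTheory Finset

theorem sum_prod_mul_pow_card_fiber {ι : Type*} [Fintype ι] [DecidableEq ι] (q : ι → ℝ)
    (hqsum : ∑ i, q i = 1) (B : ℕ) (i : ι) (x : ℝ) :
    ∑ h : Fin B → ι, (∏ b, q (h b)) * x ^ #{b | h b = i} = (1 - q i + q i * x) ^ B := by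
  have hsum : ∑ j, q j * (if j = i then x else 1) = 1 - q i + q i * x := by
    rw [← Finset.add_sum_erase univ q (mem_univ i)] at hqsum
    rw [← Finset.add_sum_erase univ (fun j => q j * (if j = i then x else 1)) (mem_univ i)]
    have : ∑ j ∈ univ.erase i, q j * (if j = i then x else 1) = ∑ j ∈ univ.erase i, q j :=
      Finset.sum_congr rfl fun j hj => by simp [Finset.ne_of_mem_erase hj]
    rw [this]
    simp only [if_true]
    linarith
  rw [← hsum, Fintype.sum_pow]
  refine Finset.sum_congr rfl fun h _ => ?_
  rw [Finset.prod_mul_distrib, Finset.prod_ite]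
  simp

theorem sum_prod_div_card_fiber_add_one_le {ι : Type*} [Fintype ι] [DecidableEq ι] (q : ι → ℝ)
    (hq : ∀ i, 0 < q i) (hqsum : ∑ i, q i = 1) (B : ℕ) (i : ι) :
    ∑ h : Fin B → ι, (∏ b, q (h b)) * (1 / ((#{b | h b = i} : ℝ) + 1)) ≤
      1 / (((B : ℝ) + 1) * q i) := by
  have hq1 : q i ≤ 1 := hqsum ▸ Finset.single_le_sum (fun j _ => (hq j).le) (mem_univ i)
  have hpow (n : ℕ) : 1 / ((n : ℝ) + 1) = ∫ x in (0 : ℝ)..1, x ^ n := by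
    simp [integral_pow]
  simp_rw [hpow, ← intervalIntegral.integral_const_mul]
  rw [← intervalIntegral.integral_finsetSum
    fun h _ => (by fun_prop : Continuous fun x : ℝ =>
      (∏ b, q (h b)) * x ^ #{b | h b = i}).intervalIntegrable _ _]
  simp_rw [sum_prod_mul_pow_card_fiber q hqsum]
  rw [intervalIntegral.integral_comp_add_mul (fun x => x ^ B) (hq i).ne', integral_pow]
  have hnonneg : 0 ≤ (1 - q i) ^ (B + 1) := pow_nonneg (by linarith) _
  simp only [mul_zero, add_zero, mul_one, sub_add_cancel, one_pow, smul_eq_mul]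
  rw [inv_mul_eq_div, div_div]
  have := hq i
  gcongr
  linarith

theorem sum_prod_eq_one {ι : Type*} [Fintype ι] [DecidableEq ι] (q : ι → ℝ)
    (hqsum : ∑ i, q i = 1) (B : ℕ) : ∑ h : Fin B → ι, ∏ b, q (h b) = 1 := by
  rw [← Fintype.sum_pow, hqsum, one_pow]

theorem sum_comp_eq_sum_card_fiber {ι : Type*} [Fintype ι] [DecidableEq ι] {B : ℕ}
    (h : Fin B → ι) (f : ι → ℝ) :
    ∑ b, f (h b) = ∑ i, (#{b | h b = i} : ℝ) * f i := by
  rw [← Finset.sum_fiberwise univ h]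
  refine Finset.sum_congr rfl fun i _ => ?_
  rw [Finset.sum_congr rfl fun b hb => by rw [(Finset.mem_filter.mp hb).2]]
  simp

theorem mul_sqrt_pow_three_le {n S p : ℝ} (hn : n = 0 ∨ 1 ≤ n) (hS : 0 ≤ S)
    (hp : 0 ≤ p) (hnp : n * p ≤ S) :
    n * √p ^ 3 ≤ S * (1 / 2 + S * (1 / (n + 1))) := by
  rcases hn with rfl | hn
  · simp only [zero_mul]; positivity
  have hsqrt : √p ≤ 1 / 2 + p / 2 := by
    nlinarith [sq_nonneg (√p - 1), Real.sq_sqrt hp]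
  have hp_le : p / 2 ≤ S * (1 / (n + 1)) := by
    rw [mul_one_div, div_le_div_iff₀ two_pos (by linarith)]
    nlinarith
  calc n * √p ^ 3 = n * p * √p := by rw [pow_succ, Real.sq_sqrt hp]; ring
    _ ≤ S * (1 / 2 + S * (1 / (n + 1))) := by gcongr; linarith

theorem exists_expected_ratio_le {ι : Type*} [Fintype ι] [DecidableEq ι] (q : ι → ℝ)
    (hq : ∀ i, 0 < q i) (hqsum : ∑ i, q i = 1) {Pbar K c : ℝ} (hPbar : 0 < Pbar) (hK : 0 < K)
    (hc : 0 < c) (T V : ι → ℝ → ℝ) (hT_nonneg : ∀ i p, 0 ≤ T i p)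
    (hT : ∀ i p, 0 ≤ p → T i p ≤ K * (√p ^ 3 + 1))
    (hV : ∀ i p, 0 ≤ p → c * p ≤ V i p) :
    ∃ C' : ℝ, 0 < C' ∧ ∀ B : ℕ, 0 < B → ∀ P : (Fin B → ι) → ι → ℝ,
      (∀ h i, 0 ≤ P h i) →
      (∀ h : Fin B → ι, ∑ i, ((#{b | h b = i} : ℝ) / B) * P h i = Pbar) →
      ∑ h : Fin B → ι, (∏ b, q (h b)) *
        ((∑ b, T (h b) (P h (h b))) / (∑ b, V (h b) (P h (h b))) ^ ((3 : ℝ) / 2)) ≤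
        C' / √B := by
  set D : ℝ := K * (Pbar * ∑ i, (1 / 2 + Pbar / q i) + 1) with hD
  have hDpos : 0 < D := by
    have : 0 ≤ ∑ i, (1 / 2 + Pbar / q i) := Finset.sum_nonneg fun i _ => by
      have := hq i
      positivity
    positivity
  refine ⟨D / (c * Pbar) ^ ((3 : ℝ) / 2), by positivity, fun B hB P hP hsum => ?_⟩
  have hB' : (0 : ℝ) < B := by exact_mod_cast hB
  have htotal (h : Fin B → ι) : ∑ i, (#{b | h b = i} : ℝ) * P h i = B * Pbar := by
    rw [← hsum h, Finset.mul_sum]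
    refine Finset.sum_congr rfl fun i _ => ?_
    field_simp
  have hV_le (h : Fin B → ι) : c * Pbar * B ≤ ∑ b, V (h b) (P h (h b)) := by
    calc c * Pbar * B = ∑ b, c * P h (h b) := by
          rw [← Finset.mul_sum, sum_comp_eq_sum_card_fiber h (P h), htotal]; ring
      _ ≤ _ := Finset.sum_le_sum fun b _ => hV _ _ (hP _ _)
  have hT_le (h : Fin B → ι) : ∑ b, T (h b) (P h (h b)) ≤
      K * (∑ i, B * Pbar * (1 / 2 + B * Pbar * (1 / ((#{b | h b = i} : ℝ) + 1))) + B) := by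
    calc ∑ b, T (h b) (P h (h b)) ≤ ∑ b, K * (√(P h (h b)) ^ 3 + 1) :=
          Finset.sum_le_sum fun b _ => hT _ _ (hP _ _)
      _ = K * (∑ i, (#{b | h b = i} : ℝ) * √(P h i) ^ 3 + B) := by
          rw [← Finset.mul_sum, Finset.sum_add_distrib,
            sum_comp_eq_sum_card_fiber h (fun i => √(P h i) ^ 3)]
          simp
      _ ≤ _ := by
          refine mul_le_mul_of_nonneg_left
            (add_le_add_left (Finset.sum_le_sum fun i _ => ?_) _) hK.le
          refine mul_sqrt_pow_three_le ?_ (mul_nonneg hB'.le hPbar.le) (hP h i) ?_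
          · rcases Nat.eq_zero_or_pos #{b | h b = i} with h0 | h0
            · exact Or.inl (by exact_mod_cast h0)
            · exact Or.inr (by exact_mod_cast h0)
          · rw [← htotal h]
            exact Finset.single_le_sum (f := fun i => (#{b | h b = i} : ℝ) * P h i)
              (fun j _ => mul_nonneg (by positivity) (hP h j)) (mem_univ i)
  have hw (h : Fin B → ι) : 0 ≤ ∏ b, q (h b) := Finset.prod_nonneg fun b _ => (hq _).le
  have hmean : ∑ h : Fin B → ι, (∏ b, q (h b)) * (∑ b, T (h b) (P h (h b))) ≤ D * B := by
    calc _ ≤ ∑ h : Fin B → ι, (∏ b, q (h b)) *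
          (K * (∑ i, B * Pbar * (1 / 2 + B * Pbar * (1 / ((#{b | h b = i} : ℝ) + 1))) + B)) :=
          Finset.sum_le_sum fun h _ => mul_le_mul_of_nonneg_left (hT_le h) (hw h)
      _ = K * (∑ i, B * Pbar * (1 / 2 + B * Pbar * ∑ h : Fin B → ι,
            (∏ b, q (h b)) * (1 / ((#{b | h b = i} : ℝ) + 1))) + B) := by
          have hterm (h : Fin B → ι) : (∏ b, q (h b)) * (K * (∑ i, B * Pbar *
              (1 / 2 + B * Pbar * (1 / ((#{b | h b = i} : ℝ) + 1))) + B)) =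
              K * (∑ i, B * Pbar * ((∏ b, q (h b)) * (1 / 2) + B * Pbar *
                ((∏ b, q (h b)) * (1 / ((#{b | h b = i} : ℝ) + 1)))) + (∏ b, q (h b)) * B) := by
            rw [mul_left_comm, mul_add, Finset.mul_sum]
            congr 2
            exact Finset.sum_congr rfl fun i _ => by ring
          simp_rw [hterm]
          rw [← Finset.mul_sum, Finset.sum_add_distrib, ← Finset.sum_mul,
            sum_prod_eq_one q hqsum, one_mul, Finset.sum_comm]
          congr 2
          refine Finset.sum_congr rfl fun i _ => ?_
          rw [← Finset.mul_sum, Finset.sum_add_distrib, ← Finset.sum_mul,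
            sum_prod_eq_one q hqsum, one_mul, ← Finset.mul_sum]
      _ ≤ K * (∑ i, B * Pbar * (1 / 2 + Pbar / q i) + B) := by
          gcongr with i _
          refine (mul_le_mul_of_nonneg_left (sum_prod_div_card_fiber_add_one_le q hq hqsum B i)
            (by positivity)).trans ?_
          have := hq i
          rw [mul_one_div, div_le_div_iff₀ (by positivity) this]
          nlinarith [mul_pos hPbar this]
      _ = D * B := by rw [← Finset.mul_sum, hD]; ring
  calc _ ≤ ∑ h : Fin B → ι, (∏ b, q (h b)) *
          ((∑ b, T (h b) (P h (h b))) / (c * Pbar * B) ^ ((3 : ℝ) / 2)) := by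
        gcongr with h _
        · exact hw h
        · exact Finset.sum_nonneg fun b _ => hT_nonneg _ _
        · exact hV_le h
    _ = (∑ h : Fin B → ι, (∏ b, q (h b)) * (∑ b, T (h b) (P h (h b)))) /
          (c * Pbar * B) ^ ((3 : ℝ) / 2) := by
        rw [Finset.sum_div]
        exact Finset.sum_congr rfl fun h _ => (mul_div_assoc _ _ _).symm
    _ ≤ D * B / (c * Pbar * B) ^ ((3 : ℝ) / 2) := by gcongr
    _ = D / (c * Pbar) ^ ((3 : ℝ) / 2) / √B := by
        have hB32 : (B : ℝ) ^ ((3 : ℝ) / 2) = B * √B := by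
          rw [Real.sqrt_eq_rpow, ← Real.rpow_one_add' hB'.le (by norm_num)]
          norm_num
        rw [Real.mul_rpow (by positivity) hB'.le, hB32]
        field_simp

theorem integrable_abs_pow_gaussianReal (n : ℕ) :
    Integrable (fun z : ℝ => |z| ^ n) (gaussianReal 0 1) := by
  simpa using (memLp_id_gaussianReal' (μ := 0) (v := 1) n (by simp)).integrable_norm_pow'

theorem abs_add_pow_three_le (x y : ℝ) : |x + y| ^ 3 ≤ 4 * (|x| ^ 3 + |y| ^ 3) := by
  have := add_pow_le (abs_nonneg x) (abs_nonneg y) 3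
  norm_num at this
  exact (pow_le_pow_left₀ (abs_nonneg _) (abs_add_le x y) 3).trans this

theorem exists_integral_abs_pow_three_gaussianReal_le (a b d : ℝ) :
    ∃ K : ℝ, 0 < K ∧ ∀ p : ℝ, 0 ≤ p →
      ∫ z, |(a * √p * z - b * (z ^ 2 - 1)) / d| ^ 3 ∂(gaussianReal 0 1) ≤ K * (√p ^ 3 + 1) := by
  set M := fun k : ℕ => ∫ z, |z| ^ k ∂(gaussianReal 0 1) with hM
  have hM0 (k) : 0 ≤ M k := integral_nonneg fun z => by positivity
  have hM6 : 0 ≤ M 6 + 1 := by linarith [hM0 6]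
  refine ⟨4 * |a / d| ^ 3 * M 3 + 16 * |b / d| ^ 3 * (M 6 + 1) + 1,
    by have := hM0 3; positivity, fun p hp => ?_⟩
  have hbound (z : ℝ) : |(a * √p * z - b * (z ^ 2 - 1)) / d| ^ 3 ≤
      4 * |a / d| ^ 3 * √p ^ 3 * |z| ^ 3 + 16 * |b / d| ^ 3 * (|z| ^ 6 + 1) := by
    have h1 : (a * √p * z - b * (z ^ 2 - 1)) / d =
        a / d * √p * z + -(b / d) * (z ^ 2 + -1) := by ring
    have h2 : |z ^ 2 + -1| ^ 3 ≤ 4 * (|z| ^ 6 + 1) := by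
      refine (abs_add_pow_three_le _ _).trans_eq ?_
      rw [abs_pow, abs_neg, abs_one]
      ring
    have h3 := abs_add_pow_three_le (a / d * √p * z) (-(b / d) * (z ^ 2 + -1))
    rw [← h1, abs_mul, abs_mul, abs_mul (-(b / d)), abs_neg, abs_of_nonneg (Real.sqrt_nonneg p),
      mul_pow, mul_pow, mul_pow] at h3
    nlinarith [mul_le_mul_of_nonneg_left h2 (by positivity : 0 ≤ |b / d| ^ 3)]
  have hint3 := (integrable_abs_pow_gaussianReal 3).const_mul (4 * |a / d| ^ 3 * √p ^ 3)
  have hint6 : Integrable (fun z : ℝ => 16 * |b / d| ^ 3 * (|z| ^ 6 + 1)) (gaussianReal 0 1) :=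
    (integrable_abs_pow_gaussianReal 6).add (integrable_const (1 : ℝ)) |>.const_mul
    (16 * |b / d| ^ 3)
  calc _ ≤ ∫ z, (4 * |a / d| ^ 3 * √p ^ 3 * |z| ^ 3 + 16 * |b / d| ^ 3 * (|z| ^ 6 + 1))
        ∂(gaussianReal 0 1) :=
        integral_mono_of_nonneg (.of_forall fun z => by positivity) (hint3.add hint6)
          (.of_forall hbound)
    _ = 4 * |a / d| ^ 3 * √p ^ 3 * M 3 + 16 * |b / d| ^ 3 * (M 6 + 1) := by
        rw [integral_add hint3 hint6, integral_const_mul, integral_const_mul,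
          integral_add (integrable_abs_pow_gaussianReal 6) (integrable_const _)]
        simp [hM]
    _ ≤ _ := by
        have h3 : 0 ≤ 4 * |a / d| ^ 3 * M 3 := by have := hM0 3; positivity
        have h6 : 0 ≤ 16 * |b / d| ^ 3 * (M 6 + 1) := by positivity
        have hp3 : 0 ≤ √p ^ 3 := by positivity
        nlinarith [mul_nonneg h6 hp3]

open MeasureTheory ProbabilityTheory in
/-- Berry–Esseen ratio bound.  Fix fading values `η i > 0` with probabilities
`q i > 0` summing to one, noise variance `σ² > 0`, water level `λ > 0` and power
budget `P̄ > 0`; set `g i ² = η i ² · max (λ − σ²/η i ²) 0`.  There is a constant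
`C' > 0`, independent of `B`, such that for every `B ≥ 1` and every power
allocation rule `P` satisfying the empirical constraint
`∑ i, t i h * P h i = P̄` for all fading realizations `h`, one has
`E[τ(H) / ν(H)^{3/2}] ≤ C' / √B`, where `ν(h)` is the total conditional variance
and `τ(h)` the total conditional third absolute moment (under the standard
Gaussian measure) of the centered per-block information densities. -/
theorem berry_esseen_ratio_bound {m : ℕ} (hm : 0 < m)
    (η : Fin m → ℝ) (hη : ∀ i, 0 < η i)
    (q : Fin m → ℝ) (hq : ∀ i, 0 < q i) (hqsum : ∑ i, q i = 1)
    (σ lam Pbar : ℝ) (hσ : 0 < σ) (hlam : 0 < lam) (hPbar : 0 < Pbar) :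
    ∃ C' : ℝ, 0 < C' ∧
      ∀ (B : ℕ), 0 < B →
        ∀ P : (Fin B → Fin m) → Fin m → ℝ,
          (∀ h i, 0 ≤ P h i) →
          (∀ h : Fin B → Fin m,
            ∑ i, (((Finset.univ.filter fun b => h b = i).card : ℝ) / B) * P h i = Pbar) →
          ∑ h : Fin B → Fin m, (∏ b, q (h b)) *
            ((∑ b, ∫ z, |(2 * η (h b) * σ ^ 2 * Real.sqrt (P h (h b)) * z
                  - ((η (h b)) ^ 2 * max (lam - σ ^ 2 / (η (h b)) ^ 2) 0) * (z ^ 2 - 1))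
                / (2 * σ ^ 2 * (σ ^ 2
                  + (η (h b)) ^ 2 * max (lam - σ ^ 2 / (η (h b)) ^ 2) 0))| ^ 3
                ∂(gaussianReal 0 1))
              / (∑ b, (2 * σ ^ 2 * (η (h b)) ^ 2 * P h (h b)
                  + ((η (h b)) ^ 2 * max (lam - σ ^ 2 / (η (h b)) ^ 2) 0) ^ 2)
                / (2 * (σ ^ 2
                  + (η (h b)) ^ 2 * max (lam - σ ^ 2 / (η (h b)) ^ 2) 0) ^ 2))
                ^ ((3 : ℝ) / 2))
            ≤ C' / Real.sqrt B := by
  have : Nonempty (Fin m) := ⟨⟨0, hm⟩⟩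
  set g : Fin m → ℝ := fun i => (η i) ^ 2 * max (lam - σ ^ 2 / (η i) ^ 2) 0 with hg
  have hg0 (i) : 0 ≤ g i := mul_nonneg (sq_nonneg _) (le_max_right _ _)
  have hσg (i) : 0 < σ ^ 2 + g i := by have := hg0 i; positivity
  choose K hKpos hK using fun i =>
    exists_integral_abs_pow_three_gaussianReal_le (2 * η i * σ ^ 2) (g i) (2 * σ ^ 2 * (σ ^ 2 + g i))
  obtain ⟨i₁, hi₁⟩ := Finite.exists_max K
  obtain ⟨i₀, hi₀⟩ := Finite.exists_min fun i => σ ^ 2 * (η i) ^ 2 / (σ ^ 2 + g i) ^ 2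
  have hc : 0 < σ ^ 2 * (η i₀) ^ 2 / (σ ^ 2 + g i₀) ^ 2 := by
    have := hη i₀
    have := hσg i₀
    positivity
  refine exists_expected_ratio_le q hq hqsum hPbar (hKpos i₁) hc
    (fun i p => ∫ z, |(2 * η i * σ ^ 2 * √p * z - g i * (z ^ 2 - 1)) /
      (2 * σ ^ 2 * (σ ^ 2 + g i))| ^ 3 ∂(gaussianReal 0 1))
    (fun i p => (2 * σ ^ 2 * (η i) ^ 2 * p + g i ^ 2) / (2 * (σ ^ 2 + g i) ^ 2))
    (fun i p => integral_nonneg fun z => by positivity)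
    (fun i p hp => (hK i p hp).trans (by gcongr; exact hi₁ i)) fun i p hp => ?_
  refine (mul_le_mul_of_nonneg_right (hi₀ i) hp).trans ?_
  have := hσg i
  rw [div_mul_eq_mul_div, div_le_div_iff₀ (by positivity) (by positivity)]
  nlinarith [mul_nonneg (sq_nonneg (g i)) (sq_nonneg (σ ^ 2 + g i))]
end
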